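/- Let N, m be positive integers, A1, A2 left-stochastic N×N real matrices, and D_1, …, D_N real symmetric m×m matrices. Set D = blockdiag(D_1, …, D_N), 𝒜1 = A1 ⊗ I_m, 𝒜2 = A2 ⊗ I_m. Then for every x ∈ ℝ^{Nm}, ‖𝒜2ᵀ D 𝒜1ᵀ x‖_{b,∞} ≤ (max_{1≤k≤N} ρ(D_k)) · ‖x‖_{b,∞}. -/

import Mathlib

open Matrix Filter Topology
open scoped Kronecker BigOperators

/-- A real square matrix is left-stochastic if all its entries are nonnegative and
each of its columns sums to one. -/
def LeftStochastic {N : ℕ} (A : Matrix (Fin N) (Fin N) ℝ) : Prop :=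
  (∀ i j, 0 ≤ A i j) ∧ ∀ j, ∑ i, A i j = 1

/-- Block-diagonal matrix with blocks `D 0, …, D (N-1)`. -/
def blockDiag {N m : ℕ} (D : Fin N → Matrix (Fin m) (Fin m) ℝ) :
    Matrix (Fin N × Fin m) (Fin N × Fin m) ℝ :=
  Matrix.of fun p q => if p.1 = q.1 then D p.1 p.2 q.2 else 0

/-- The spectral radius of a real (symmetric) matrix: the largest absolute value of
its real eigenvalues. -/
noncomputable def specRad {m : ℕ} (D : Matrix (Fin m) (Fin m) ℝ) : ℝ :=
  sSup ((fun lam => |lam|) '' spectrum ℝ D)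

/-- The block-maximum norm of a vector in ℝ^(Nm): the maximum over the N blocks of
the Euclidean norm of each block. -/
noncomputable def blockMaxNorm {N m : ℕ} (x : Fin N × Fin m → ℝ) : ℝ :=
  ⨆ k : Fin N, Real.sqrt (∑ j, (x (k, j)) ^ 2)

/-- The `k`-th block of a vector, as an element of Euclidean space. -/
def euclideanBlock {N m : ℕ} (x : Fin N × Fin m → ℝ) (k : Fin N) : EuclideanSpace ℝ (Fin m) :=
  WithLp.toLp 2 fun j => x (k, j)

lemma blockMaxNorm_eq_iSup_norm {N m : ℕ} (x : Fin N × Fin m → ℝ) :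
    blockMaxNorm x = ⨆ k, ‖euclideanBlock x k‖ := by
  simp [blockMaxNorm, euclideanBlock, EuclideanSpace.norm_eq]

lemma norm_euclideanBlock_le {N m : ℕ} (x : Fin N × Fin m → ℝ) (k : Fin N) :
    ‖euclideanBlock x k‖ ≤ blockMaxNorm x := by
  rw [blockMaxNorm_eq_iSup_norm]
  exact le_ciSup (f := fun k => ‖euclideanBlock x k‖) (Set.finite_range _).bddAbove k

lemma blockMaxNorm_nonneg {N m : ℕ} (x : Fin N × Fin m → ℝ) : 0 ≤ blockMaxNorm x :=
  Real.iSup_nonneg fun _ => Real.sqrt_nonneg _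

lemma blockMaxNorm_le {N m : ℕ} {x : Fin N × Fin m → ℝ} {c : ℝ} (hc : 0 ≤ c)
    (h : ∀ k, ‖euclideanBlock x k‖ ≤ c) : blockMaxNorm x ≤ c := by
  rw [blockMaxNorm_eq_iSup_norm]
  exact Real.iSup_le h hc

lemma euclideanBlock_kronecker_transpose_mulVec {N m : ℕ} (A : Matrix (Fin N) (Fin N) ℝ)
    (x : Fin N × Fin m → ℝ) (k : Fin N) :
    euclideanBlock ((A ⊗ₖ (1 : Matrix (Fin m) (Fin m) ℝ))ᵀ *ᵥ x) k =
      ∑ l, A l k • euclideanBlock x l := by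
  ext j
  simp [euclideanBlock, Matrix.mulVec, dotProduct, Fintype.sum_prod_type, Matrix.one_apply]

lemma euclideanBlock_blockDiag_mulVec {N m : ℕ} (D : Fin N → Matrix (Fin m) (Fin m) ℝ)
    (x : Fin N × Fin m → ℝ) (k : Fin N) :
    euclideanBlock ((_root_.blockDiag D) *ᵥ x) k = (D k).toEuclideanLin (euclideanBlock x k) := by
  ext j
  simp [euclideanBlock, Matrix.mulVec, dotProduct, Fintype.sum_prod_type, _root_.blockDiag,
    Matrix.toLpLin_apply, ite_mul, Finset.sum_ite_irrel]

lemma LeftStochastic.blockMaxNorm_transpose_mulVec_le {N m : ℕ} {A : Matrix (Fin N) (Fin N) ℝ}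
    (hA : LeftStochastic A) (x : Fin N × Fin m → ℝ) :
    blockMaxNorm ((A ⊗ₖ (1 : Matrix (Fin m) (Fin m) ℝ))ᵀ *ᵥ x) ≤ blockMaxNorm x := by
  refine blockMaxNorm_le (blockMaxNorm_nonneg x) fun k => ?_
  rw [euclideanBlock_kronecker_transpose_mulVec]
  calc ‖∑ l, A l k • euclideanBlock x l‖ ≤ ∑ l, A l k * blockMaxNorm x := by
        refine norm_sum_le_of_le _ fun l _ => ?_
        rw [norm_smul, Real.norm_of_nonneg (hA.1 l k)]
        exact mul_le_mul_of_nonneg_left (norm_euclideanBlock_le x l) (hA.1 l k)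
    _ = blockMaxNorm x := by rw [← Finset.sum_mul, hA.2 k, one_mul]

lemma abs_le_specRad {m : ℕ} {D : Matrix (Fin m) (Fin m) ℝ} {r : ℝ} (hr : r ∈ spectrum ℝ D) :
    |r| ≤ specRad D :=
  le_csSup ((Matrix.finite_real_spectrum (A := D)).image _).bddAbove ⟨r, hr, rfl⟩

lemma specRad_nonneg {m : ℕ} (D : Matrix (Fin m) (Fin m) ℝ) : 0 ≤ specRad D := by
  refine Real.sSup_nonneg ?_
  rintro _ ⟨r, -, rfl⟩
  exact abs_nonneg r

lemma norm_toEuclideanLin_le_specRad_mul {m : ℕ} {D : Matrix (Fin m) (Fin m) ℝ}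
    (hD : D.IsHermitian) (v : EuclideanSpace ℝ (Fin m)) :
    ‖D.toEuclideanLin v‖ ≤ specRad D * ‖v‖ := by
  refine le_of_sq_le_sq ?_ (mul_nonneg (specRad_nonneg D) (norm_nonneg v))
  rw [mul_pow, ← hD.eigenvectorBasis.sum_sq_norm_inner_right,
    ← hD.eigenvectorBasis.sum_sq_norm_inner_right v, Finset.mul_sum]
  refine Finset.sum_le_sum fun i _ => ?_
  have hb : D.toEuclideanLin (hD.eigenvectorBasis i) =
      hD.eigenvalues i • hD.eigenvectorBasis i := by
    ext j
    simp [Matrix.toLpLin_apply, hD.mulVec_eigenvectorBasis i]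
  rw [← (Matrix.isSymmetric_toEuclideanLin_iff.mpr hD) _ _, hb, real_inner_smul_left,
    norm_mul, mul_pow]
  gcongr
  exact abs_le_specRad (hD.eigenvalues_mem_spectrum_real i)

lemma blockMaxNorm_blockDiag_mulVec_le {N m : ℕ} {D : Fin N → Matrix (Fin m) (Fin m) ℝ}
    (hD : ∀ k, (D k).IsHermitian) (x : Fin N × Fin m → ℝ) :
    blockMaxNorm ((_root_.blockDiag D) *ᵥ x) ≤ (⨆ k, specRad (D k)) * blockMaxNorm x := by
  have hρ : 0 ≤ ⨆ k, specRad (D k) := Real.iSup_nonneg fun k => specRad_nonneg (D k)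
  refine blockMaxNorm_le (mul_nonneg hρ (blockMaxNorm_nonneg x)) fun k => ?_
  rw [euclideanBlock_blockDiag_mulVec]
  exact (norm_toEuclideanLin_le_specRad_mul (hD k) _).trans <|
    mul_le_mul (le_ciSup (f := fun k => specRad (D k)) (Set.finite_range _).bddAbove k)
      (norm_euclideanBlock_le x k) (norm_nonneg _) hρ

theorem stmt3 {N m : ℕ} (hN : 0 < N) (hm : 0 < m)
    (A1 A2 : Matrix (Fin N) (Fin N) ℝ)
    (hA1 : LeftStochastic A1) (hA2 : LeftStochastic A2)
    (D : Fin N → Matrix (Fin m) (Fin m) ℝ)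
    (hD : ∀ k, (D k).IsHermitian) :
    ∀ x : Fin N × Fin m → ℝ,
      blockMaxNorm (((A2 ⊗ₖ (1 : Matrix (Fin m) (Fin m) ℝ))ᵀ * blockDiag D *
          (A1 ⊗ₖ (1 : Matrix (Fin m) (Fin m) ℝ))ᵀ) *ᵥ x) ≤
        (⨆ k : Fin N, specRad (D k)) * blockMaxNorm x := by
  intro x
  rw [← Matrix.mulVec_mulVec, ← Matrix.mulVec_mulVec]
  refine (hA2.blockMaxNorm_transpose_mulVec_le _).trans ?_
  refine (blockMaxNorm_blockDiag_mulVec_le hD _).trans ?_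
  exact mul_le_mul_of_nonneg_left (hA1.blockMaxNorm_transpose_mulVec_le x)
    (Real.iSup_nonneg fun k => specRad_nonneg (D k))
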